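/- arXiv:2305.15557 — 3 statements merged into one kernel-verified Lean document; each statement's English description precedes it below -/
import Mathlib

section
/- Let n ≥ 1 be an integer, let ν and k be real numbers with 0 ≤ ν ≤ k, and let R ≥ 1. Let g₁, g₂ : ℝ^n → ℂ be measurable with g₁ − g₂ ∈ L²(ℝ^n, ℂ), suppose ∫ (1 + ‖z‖²)^k |g₁(z)|² dz < ∞, and suppose g₂(z) = 0 for almost every z with ‖z‖ > R. Then ( ∫ (1 + ‖z‖²)^ν |g₁(z) − g₂(z)|² dz )^{1/2} ≤ R^{ν − k} ( ∫ (1 + ‖z‖²)^k |g₁(z)|² dz )^{1/2} + 2^ν R^ν ( ∫_{‖z‖ ≤ R} |g₁(z) − g₂(z)|² dz )^{1/2}. -/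
open MeasureTheory
open scoped ENNReal

/-- Frequency-splitting bound: if `0 ≤ ν ≤ k`, `R ≥ 1`, `g₁ - g₂ ∈ L²`,
`∫ (1+‖z‖²)^k |g₁|² < ∞` and `g₂` vanishes a.e. outside the ball of radius `R`, then
`(∫ (1+‖z‖²)^ν |g₁-g₂|²)^{1/2}
  ≤ R^{ν-k} (∫ (1+‖z‖²)^k |g₁|²)^{1/2} + 2^ν R^ν (∫_{‖z‖ ≤ R} |g₁-g₂|²)^{1/2}`. -/
theorem stmt3 (n : ℕ) (hn : 1 ≤ n) (ν k : ℝ) (hν : 0 ≤ ν) (hνk : ν ≤ k)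
    (R : ℝ) (hR : 1 ≤ R) (g₁ g₂ : EuclideanSpace ℝ (Fin n) → ℂ)
    (hg₁ : Measurable g₁) (hg₂ : Measurable g₂)
    (hL2 : MemLp (g₁ - g₂) 2 volume)
    (hfin : ∫⁻ z, ENNReal.ofReal ((1 + ‖z‖ ^ 2) ^ k) * (‖g₁ z‖₊ : ℝ≥0∞) ^ 2 < ⊤)
    (hsupp : ∀ᵐ z : EuclideanSpace ℝ (Fin n), R < ‖z‖ → g₂ z = 0) :
    (∫⁻ z, ENNReal.ofReal ((1 + ‖z‖ ^ 2) ^ ν) *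
        (‖g₁ z - g₂ z‖₊ : ℝ≥0∞) ^ 2) ^ (1/2 : ℝ) ≤
      ENNReal.ofReal (R ^ (ν - k)) *
        (∫⁻ z, ENNReal.ofReal ((1 + ‖z‖ ^ 2) ^ k) * (‖g₁ z‖₊ : ℝ≥0∞) ^ 2) ^ (1/2 : ℝ) +
      ENNReal.ofReal (2 ^ ν * R ^ ν) *
        (∫⁻ z in {z : EuclideanSpace ℝ (Fin n) | ‖z‖ ≤ R},
          (‖g₁ z - g₂ z‖₊ : ℝ≥0∞) ^ 2) ^ (1/2 : ℝ) := by
  have hR0 : 0 < R := by linarith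
  have hS : MeasurableSet {z : EuclideanSpace ℝ (Fin n) | ‖z‖ ≤ R} :=
    measurableSet_le measurable_norm measurable_const
  have hin : (∫⁻ z in {z : EuclideanSpace ℝ (Fin n) | ‖z‖ ≤ R},
      ENNReal.ofReal ((1 + ‖z‖ ^ 2) ^ ν) * (‖g₁ z - g₂ z‖₊ : ℝ≥0∞) ^ 2) ≤
      ENNReal.ofReal (2 ^ ν * R ^ ν) ^ 2 *
        ∫⁻ z in {z : EuclideanSpace ℝ (Fin n) | ‖z‖ ≤ R}, (‖g₁ z - g₂ z‖₊ : ℝ≥0∞) ^ 2 := by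
    rw [← lintegral_const_mul' _ _ (by finiteness)]
    refine setLIntegral_mono' hS fun z hz => ?_
    have hz' : ‖z‖ ≤ R := hz
    gcongr
    rw [← ENNReal.ofReal_pow (by positivity)]
    apply ENNReal.ofReal_le_ofReal
    rw [← Real.mul_rpow (by norm_num) hR0.le, ← Real.rpow_natCast ((2 * R) ^ ν), ← Real.rpow_mul (by positivity),
      mul_comm ν, Real.rpow_mul (by positivity), Real.rpow_natCast]
    refine Real.rpow_le_rpow (by positivity) ?_ hν
    nlinarith [norm_nonneg z]
  have hout : (∫⁻ z in {z : EuclideanSpace ℝ (Fin n) | ‖z‖ ≤ R}ᶜ,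
      ENNReal.ofReal ((1 + ‖z‖ ^ 2) ^ ν) * (‖g₁ z - g₂ z‖₊ : ℝ≥0∞) ^ 2) ≤
      ENNReal.ofReal (R ^ (ν - k)) ^ 2 *
        ∫⁻ z, ENNReal.ofReal ((1 + ‖z‖ ^ 2) ^ k) * (‖g₁ z‖₊ : ℝ≥0∞) ^ 2 := by
    refine le_trans ?_ (mul_le_mul_right (setLIntegral_le_lintegral
      {z : EuclideanSpace ℝ (Fin n) | ‖z‖ ≤ R}ᶜ _) _)
    rw [← lintegral_const_mul' _ _ (by finiteness)]
    refine setLIntegral_mono_ae' hS.compl ?_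
    filter_upwards [hsupp] with z hz hzS
    have hz' : R < ‖z‖ := by simpa using hzS
    rw [hz hz', sub_zero, ← mul_assoc]
    gcongr
    rw [← ENNReal.ofReal_pow (by positivity), ← ENNReal.ofReal_mul (by positivity)]
    apply ENNReal.ofReal_le_ofReal
    have h1 : (1 + ‖z‖ ^ 2) ^ ν = (1 + ‖z‖ ^ 2) ^ (ν - k) * (1 + ‖z‖ ^ 2) ^ k := by
      rw [← Real.rpow_add (by positivity)]; ring_nf
    rw [h1]
    gcongr
    rw [← Real.rpow_natCast (R ^ (ν - k)), ← Real.rpow_mul (by positivity),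
      mul_comm (ν - k), Real.rpow_mul (by positivity), Real.rpow_natCast]
    refine Real.rpow_le_rpow_of_nonpos (by positivity) ?_ (by linarith)
    nlinarith [norm_nonneg z]
  have hsq : ∀ a F : ℝ≥0∞, (a ^ 2 * F) ^ (1/2 : ℝ) = a * F ^ (1/2 : ℝ) := by
    intro a F
    rw [ENNReal.mul_rpow_of_nonneg _ _ (by norm_num), ← ENNReal.rpow_natCast, ← ENNReal.rpow_mul]
    norm_num
  rw [← lintegral_add_compl _ hS, ← hsq, ← hsq, add_comm]
  refine le_trans (ENNReal.rpow_add_le_add_rpow _ _ (by norm_num) (by norm_num)) ?_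
  gcongr
end

section
/- Let n ≥ 1 and N ≥ 1 be integers, R > 0, and η ∈ (0, 1). Let μ be a probability measure on ℝ^n and let X₁, …, X_N be independent ℝ^n-valued random variables on a probability space (Ω, P), each with law μ. Write χ_μ(z) = ∫ e^{2πi⟨z,x⟩} dμ(x). Then with probability at least 1 − η one has ( ∫_{‖z‖ ≤ R} | χ_μ(z) − (1/N) Σ_{j=1}^N e^{2πi⟨z,X_j⟩} |² dz )^{1/2} ≤ 2√2 · (V_n R^n)^{1/2} · (log(2/η))^{1/2} / √N, where V_n is the Lebesgue volume of the unit ball in ℝ^n. -/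
open MeasureTheory
open scoped ENNReal RealInnerProductSpace

theorem cosh_aux (a s u v : ℝ) (hs1 : -1 ≤ s) (hs2 : s ≤ 1)
    (h : a ^ 2 ≤ (1 + s) / 2 * u ^ 2 + (1 - s) / 2 * v ^ 2) :
    Real.cosh a ≤ (1 + s) / 2 * Real.cosh u + (1 - s) / 2 * Real.cosh v := by
  refine hasSum_le ?_ (Real.hasSum_cosh a)
    (((Real.hasSum_cosh u).mul_left ((1 + s) / 2)).add
      ((Real.hasSum_cosh v).mul_left ((1 - s) / 2)))
  intro k
  have h1 : (a ^ 2) ^ k ≤ (1 + s) / 2 * (u ^ 2) ^ k + (1 - s) / 2 * (v ^ 2) ^ k := by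
    refine (pow_le_pow_left₀ (sq_nonneg a) h k).trans ?_
    have hc := (convexOn_pow (𝕜 := ℝ) k).2
    have := hc (Set.mem_Ici.2 (sq_nonneg u)) (Set.mem_Ici.2 (sq_nonneg v))
      (show 0 ≤ (1 + s) / 2 by linarith) (show 0 ≤ (1 - s) / 2 by linarith) (by ring)
    simpa only [smul_eq_mul] using this
  simp only [← pow_mul] at h1
  calc a ^ (2 * k) / ((2 * k).factorial : ℝ)
      ≤ ((1 + s) / 2 * u ^ (2 * k) + (1 - s) / 2 * v ^ (2 * k)) / ((2 * k).factorial : ℝ) := by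
        gcongr
    _ = _ := by ring

theorem cosh_norm_add_le {H : Type*} [NormedAddCommGroup H] [InnerProductSpace ℝ H]
    (x y : H) (b : ℝ) (hb : 0 < b) (hy : ‖y‖ ≤ b) :
    Real.cosh ‖x + y‖ ≤ Real.cosh ‖x‖ * Real.cosh b
      + (Real.sinh ‖x‖ * Real.sinh b / (‖x‖ * b)) * ⟪x, y⟫ := by
  set p := ‖x‖ with hp
  have hp0 : 0 ≤ p := norm_nonneg x
  have habs : |⟪x, y⟫| ≤ p * b :=
    (abs_real_inner_le_norm x y).trans (mul_le_mul_of_nonneg_left hy hp0)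
  have hpb : 0 ≤ p * b := by positivity
  set s := ⟪x, y⟫ / (p * b) with hs
  have hs' : |s| ≤ 1 := by
    rw [hs, abs_div, abs_of_nonneg hpb]
    exact div_le_one_of_le₀ habs hpb
  have hsp : s * (p * b) = ⟪x, y⟫ := by
    rcases hpb.eq_or_lt with h0 | h0
    · rw [← h0] at habs ⊢
      have := abs_nonpos_iff.1 habs
      rw [this]; simp
    · exact div_mul_cancel₀ _ h0.ne'
  have hn : ‖x + y‖ ^ 2 = p ^ 2 + 2 * ⟪x, y⟫ + ‖y‖ ^ 2 := norm_add_sq_real x y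
  have hy2 : ‖y‖ ^ 2 ≤ b ^ 2 := pow_le_pow_left₀ (norm_nonneg y) hy 2
  have := cosh_aux ‖x + y‖ s (p + b) (p - b) (abs_le.1 hs').1 (abs_le.1 hs').2 (by
    rw [hn, ← hsp]; nlinarith)
  rw [Real.cosh_add, Real.cosh_sub] at this
  calc _ ≤ _ := this
    _ = Real.cosh p * Real.cosh b + s * (Real.sinh p * Real.sinh b) := by ring
    _ = _ := by rw [hs]; ring

theorem lintegral_cosh_step {E H : Type*} [MeasurableSpace E] [TopologicalSpace E]
    [OpensMeasurableSpace E] [SecondCountableTopology E]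
    [NormedAddCommGroup H] [InnerProductSpace ℝ H] [CompleteSpace H]
    (μ : Measure E) [IsProbabilityMeasure μ]
    (g : E → H) (hg : Continuous g) (b : ℝ) (hb : 0 < b) (hgb : ∀ e, ‖g e‖ ≤ b)
    (hint : ∫ e, g e ∂μ = 0) (x : H) :
    ∫⁻ e, ENNReal.ofReal (Real.cosh ‖x + g e‖) ∂μ
      ≤ ENNReal.ofReal (Real.cosh ‖x‖) * ENNReal.ofReal (Real.cosh b) := by
  have hgm : AEStronglyMeasurable g μ := hg.aestronglyMeasurable
  have hgi : Integrable g μ := Integrable.of_bound hgm b (.of_forall hgb)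
  have hii : Integrable (fun e => ⟪x, g e⟫) μ := hgi.const_inner x
  have hI : Integrable (fun e => Real.cosh ‖x‖ * Real.cosh b
      + (Real.sinh ‖x‖ * Real.sinh b / (‖x‖ * b)) * ⟪x, g e⟫) μ :=
    (integrable_const _).add (hii.const_mul _)
  have hle : ∀ e, Real.cosh ‖x + g e‖ ≤ Real.cosh ‖x‖ * Real.cosh b
      + (Real.sinh ‖x‖ * Real.sinh b / (‖x‖ * b)) * ⟪x, g e⟫ :=
    fun e => cosh_norm_add_le x (g e) b hb (hgb e)
  calc _ ≤ ∫⁻ e, ENNReal.ofReal (Real.cosh ‖x‖ * Real.cosh b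
      + (Real.sinh ‖x‖ * Real.sinh b / (‖x‖ * b)) * ⟪x, g e⟫) ∂μ :=
        lintegral_mono fun e => ENNReal.ofReal_le_ofReal (hle e)
    _ = ENNReal.ofReal (∫ e, (Real.cosh ‖x‖ * Real.cosh b
      + (Real.sinh ‖x‖ * Real.sinh b / (‖x‖ * b)) * ⟪x, g e⟫) ∂μ) :=
        (ofReal_integral_eq_lintegral_ofReal hI
          (.of_forall fun e => (Real.cosh_pos _).le.trans (hle e))).symm
    _ = _ := by
      rw [integral_add (integrable_const _) (hii.const_mul _), integral_const,
        integral_const_mul (Real.sinh ‖x‖ * Real.sinh b / (‖x‖ * b)) (fun e => ⟪x, g e⟫),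
        integral_inner hgi, hint]
      simp [ENNReal.ofReal_mul (Real.cosh_pos ‖x‖).le]

theorem lintegral_cosh_sum {E H : Type*} [MeasurableSpace E] [TopologicalSpace E]
    [OpensMeasurableSpace E] [SecondCountableTopology E]
    [NormedAddCommGroup H] [InnerProductSpace ℝ H] [CompleteSpace H]
    (μ : Measure E) [IsProbabilityMeasure μ]
    (g : E → H) (hg : Continuous g) (b : ℝ) (hb : 0 < b) (hgb : ∀ e, ‖g e‖ ≤ b)
    (hint : ∫ e, g e ∂μ = 0) (N : ℕ) :
    ∫⁻ x : Fin N → E, ENNReal.ofReal (Real.cosh ‖∑ j, g (x j)‖) ∂(Measure.pi fun _ => μ)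
      ≤ ENNReal.ofReal (Real.cosh b) ^ N := by
  induction N with
  | zero => simp
  | succ N ih =>
    have hmp := measurePreserving_piFinSuccAbove (n := N) (α := fun _ => E) (fun _ => μ) 0
    have hc : Continuous (fun q : E × (Fin N → E) =>
        ENNReal.ofReal (Real.cosh ‖(∑ j, g (q.2 j)) + g q.1‖)) := by
      refine ENNReal.continuous_ofReal.comp (Real.continuous_cosh.comp ?_)
      fun_prop
    have h1 := hmp.lintegral_comp hc.measurable
    calc _ = ∫⁻ x : Fin (N+1) → E, ENNReal.ofReal (Real.cosh
              ‖(∑ j, g (x (Fin.succ j))) + g (x 0)‖) ∂(Measure.pi fun _ => μ) := by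
            simp_rw [Fin.sum_univ_succ, add_comm]
      _ = ∫⁻ q, ENNReal.ofReal (Real.cosh ‖(∑ j, g (q.2 j)) + g q.1‖)
            ∂(μ.prod (Measure.pi fun _ : Fin N => μ)) := by
        rw [← h1]
        refine lintegral_congr fun x => ?_
        simp [MeasurableEquiv.piFinSuccAbove, Fin.insertNthEquiv, Fin.tail]
      _ ≤ _ := by
        rw [lintegral_prod_symm _ hc.measurable.aemeasurable]
        have hst : ∀ y : Fin N → E,
            ∫⁻ e, ENNReal.ofReal (Real.cosh ‖(∑ j, g (y j)) + g e‖) ∂μ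
              ≤ ENNReal.ofReal (Real.cosh ‖∑ j, g (y j)‖) * ENNReal.ofReal (Real.cosh b) :=
          fun y => lintegral_cosh_step μ g hg b hb hgb hint (∑ j, g (y j))
        have h5 := lintegral_mono (μ := Measure.pi fun _ : Fin N => μ) hst
        rw [lintegral_mul_const' _ _ ENNReal.ofReal_ne_top] at h5
        rw [pow_succ]
        exact h5.trans (mul_le_mul_left ih _)

theorem pinelis {E H : Type*} [MeasurableSpace E] [TopologicalSpace E]
    [OpensMeasurableSpace E] [SecondCountableTopology E]
    [NormedAddCommGroup H] [InnerProductSpace ℝ H] [CompleteSpace H]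
    (μ : Measure E) [IsProbabilityMeasure μ]
    (g : E → H) (hg : Continuous g) (b : ℝ) (hb : 0 < b) (hgb : ∀ e, ‖g e‖ ≤ b)
    (hint : ∫ e, g e ∂μ = 0) (N : ℕ) (hN : 1 ≤ N) (t : ℝ) (ht : 0 < t) :
    (Measure.pi fun _ : Fin N => μ) {x | t ≤ ‖∑ j, g (x j)‖}
      ≤ ENNReal.ofReal (2 * Real.exp (- t ^ 2 / (2 * N * b ^ 2))) := by
  have hN' : (0 : ℝ) < N := by exact_mod_cast hN
  set l : ℝ := t / (N * b ^ 2) with hl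
  have hl0 : 0 < l := by positivity
  have h1 := lintegral_cosh_sum μ (fun e => l • g e) (hg.const_smul l) (l * b) (by positivity)
    (fun e => by rw [norm_smul, Real.norm_of_nonneg hl0.le]; gcongr; exact hgb e)
    (by rw [integral_smul, hint, smul_zero]) N
  have hc : Continuous (fun q : Fin N → E =>
        ENNReal.ofReal (Real.cosh ‖(∑ j, l • g (q j))‖)) := by
      refine ENNReal.continuous_ofReal.comp (Real.continuous_cosh.comp ?_)
      fun_prop
  have h2 := (mul_meas_ge_le_lintegral₀ (μ := Measure.pi fun _ : Fin N => μ)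
    hc.measurable.aemeasurable (ENNReal.ofReal (Real.cosh (l * t)))).trans h1
  have hsub : {x : Fin N → E | t ≤ ‖∑ j, g (x j)‖} ⊆ {x | ENNReal.ofReal (Real.cosh (l * t)) ≤
      ENNReal.ofReal (Real.cosh ‖(∑ j, l • g (x j))‖)} := by
    intro x hx
    have hx : t ≤ ‖∑ j, g (x j)‖ := hx
    refine ENNReal.ofReal_le_ofReal (Real.cosh_le_cosh.2 ?_)
    rw [← Finset.smul_sum, norm_smul, Real.norm_of_nonneg hl0.le, abs_of_pos (by positivity),
      abs_of_nonneg (by positivity)]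
    gcongr
  have hcp := Real.cosh_pos (l * t)
  have h3 : (Measure.pi fun _ : Fin N => μ) {x | t ≤ ‖∑ j, g (x j)‖} ≤
      ENNReal.ofReal (Real.cosh (l * b)) ^ N / ENNReal.ofReal (Real.cosh (l * t)) := by
    rw [ENNReal.le_div_iff_mul_le (by simp [hcp]) (by simp), mul_comm]
    refine le_trans ?_ h2
    gcongr
  refine h3.trans ?_
  rw [← ENNReal.ofReal_pow (Real.cosh_pos _).le, ← ENNReal.ofReal_div_of_pos hcp]
  refine ENNReal.ofReal_le_ofReal ?_
  rw [div_le_iff₀ hcp]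
  have e1 : Real.cosh (l * b) ^ N ≤ Real.exp (N * ((l * b) ^ 2 / 2)) := by
    rw [Real.exp_nat_mul]
    exact pow_le_pow_left₀ (Real.cosh_pos _).le (Real.cosh_le_exp_half_sq _) N
  have e2 : Real.exp (l * t) / 2 ≤ Real.cosh (l * t) := by
    rw [Real.cosh_eq]; have := Real.exp_pos (-(l * t)); linarith
  refine e1.trans ?_
  calc Real.exp (N * ((l * b) ^ 2 / 2))
      = 2 * Real.exp (- t ^ 2 / (2 * N * b ^ 2)) * (Real.exp (l * t) / 2) := by
        have : 2 * Real.exp (- t ^ 2 / (2 * N * b ^ 2)) * (Real.exp (l * t) / 2)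
          = Real.exp (- t ^ 2 / (2 * N * b ^ 2) + l * t) := by rw [Real.exp_add]; ring
        rw [this]
        congr 1
        rw [hl]; field_simp; ring
    _ ≤ _ := by gcongr

theorem charfun_conc (n N : ℕ) (hN : 1 ≤ N) (R : ℝ) (hR : 0 < R)
    (η : ℝ) (hη : η ∈ Set.Ioo (0 : ℝ) 1)
    (μ : Measure (EuclideanSpace ℝ (Fin n))) [IsProbabilityMeasure μ] :
      (Measure.pi fun _ : Fin N => μ)
        {x | ¬ ((∫⁻ z in {z : EuclideanSpace ℝ (Fin n) | ‖z‖ ≤ R},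
            (‖(∫ x, Complex.exp (Complex.I * ((2 * Real.pi * ⟪z, x⟫ : ℝ) : ℂ)) ∂μ) -
              (N : ℂ)⁻¹ * ∑ j, Complex.exp
                (Complex.I * ((2 * Real.pi * ⟪z, x j⟫ : ℝ) : ℂ))‖₊ : ℝ≥0∞) ^ 2) ^ (1/2 : ℝ) ≤
          ENNReal.ofReal (2 * Real.sqrt 2 *
            Real.sqrt ((volume (Metric.closedBall (0 : EuclideanSpace ℝ (Fin n)) 1)).toReal
              * R ^ n) * Real.sqrt (Real.log (2 / η)) / Real.sqrt N))} ≤ ENNReal.ofReal η := by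
  have hN' : (0 : ℝ) < N := by exact_mod_cast hN
  set K : Set (EuclideanSpace ℝ (Fin n)) := {z | ‖z‖ ≤ R} with hKdef
  have hK : K = Metric.closedBall 0 R := by ext; simp [hKdef]
  have hKc : IsCompact K := hK ▸ isCompact_closedBall 0 R
  have hKm : MeasurableSet K := hKc.measurableSet
  have : CompactSpace K := isCompact_iff_compactSpace.1 hKc
  set V : ℝ := (volume (Metric.closedBall (0 : EuclideanSpace ℝ (Fin n)) 1)).toReal * R ^ n
    with hV
  have hVK : volume K = ENNReal.ofReal V := by
    rw [hK, Measure.addHaar_closedBall' _ _ hR.le, hV, mul_comm, ENNReal.ofReal_mul (by positivity),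
      ENNReal.ofReal_toReal measure_closedBall_lt_top.ne]
    simp
  have hVpos : 0 < V := by
    have : 0 < (volume (Metric.closedBall (0 : EuclideanSpace ℝ (Fin n)) 1)).toReal :=
      ENNReal.toReal_pos (Metric.measure_closedBall_pos _ _ one_pos).ne'
        measure_closedBall_lt_top.ne
    positivity
  set ν : Measure K := Measure.comap Subtype.val volume with hν
  have hνu : ν Set.univ = ENNReal.ofReal V := by
    rw [hν, ← hVK, comap_subtype_coe_apply hKm]; simp
  have : IsFiniteMeasure ν := ⟨by rw [hνu]; exact ENNReal.ofReal_lt_top⟩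
  let F : C(EuclideanSpace ℝ (Fin n) × K, ℂ) :=
    ⟨fun q => Complex.exp (Complex.I * ((2 * Real.pi * ⟪(q.2 : EuclideanSpace ℝ (Fin n)), q.1⟫ : ℝ) : ℂ)),
      by fun_prop⟩
  let ζ : C(EuclideanSpace ℝ (Fin n), C(K, ℂ)) := F.curry
  have hζ : ∀ x (z : K), ζ x z = Complex.exp (Complex.I *
      ((2 * Real.pi * ⟪(z : EuclideanSpace ℝ (Fin n)), x⟫ : ℝ) : ℂ)) := fun x z => rfl
  have hζ1 : ∀ x, ‖ζ x‖ ≤ 1 := by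
    intro x
    refine (ContinuousMap.norm_le _ zero_le_one).2 fun z => ?_
    rw [hζ, mul_comm, Complex.norm_exp_ofReal_mul_I]
  have hζi : Integrable ζ μ :=
    Integrable.of_bound ζ.continuous.aestronglyMeasurable 1 (.of_forall hζ1)
  set m : C(K, ℂ) := ∫ x, ζ x ∂μ with hm
  have hm1 : ‖m‖ ≤ 1 := by
    simpa using norm_integral_le_of_norm_le_const (μ := μ) (f := ζ) (.of_forall hζ1)
  have hmz : ∀ z : K, m z = ∫ x, Complex.exp (Complex.I *
      ((2 * Real.pi * ⟪(z : EuclideanSpace ℝ (Fin n)), x⟫ : ℝ) : ℂ)) ∂μ := by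
    intro z
    exact ((ContinuousMap.evalCLM ℝ z : C(K, ℂ) →L[ℝ] ℂ).integral_comp_comm hζi).symm
  let T : C(K, ℂ) →L[ℝ] Lp ℂ 2 ν := ContinuousMap.toLp 2 ν ℝ
  have hT : ‖T‖ ≤ Real.sqrt V := by
    refine (ContinuousMap.toLp_norm_le ν).trans ?_
    rw [Real.sqrt_eq_rpow]
    have h7 : ((measureUnivNNReal ν : NNReal) : ℝ) = V := by
      change (ν Set.univ).toReal = V
      rw [hνu, ENNReal.toReal_ofReal hVpos.le]
    rw [h7]
    simp
  have hTn : ∀ f : C(K, ℂ), ‖T f‖ₑ = (∫⁻ z : K, (‖f z‖₊ : ℝ≥0∞) ^ 2 ∂ν) ^ (1/2 : ℝ) := by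
    intro f
    rw [Lp.enorm_def, eLpNorm_congr_ae (ContinuousMap.coeFn_toLp ν f),
      eLpNorm_eq_lintegral_rpow_enorm_toReal (by simp) (by simp)]
    simp [enorm_eq_nnnorm]
  let g : EuclideanSpace ℝ (Fin n) → Lp ℂ 2 ν := fun x => T (m - ζ x)
  have hL : 0 < Real.log (2 / η) := Real.log_pos (by
    rw [lt_div_iff₀ hη.1]; linarith [hη.2])
  set L := Real.log (2 / η) with hLdef
  set r : ℝ := 2 * Real.sqrt 2 * Real.sqrt V * Real.sqrt L / Real.sqrt N with hr
  have hr0 : 0 < r := by positivity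
  have key := pinelis μ g (by fun_prop) (2 * Real.sqrt V) (by positivity)
    (fun e => by
      calc ‖T (m - ζ e)‖ ≤ ‖T‖ * ‖m - ζ e‖ := T.le_opNorm _
        _ ≤ Real.sqrt V * 2 := by
          gcongr
          exact (norm_sub_le _ _).trans (by linarith [hζ1 e])
        _ = _ := by ring)
    (by
      change ∫ e, T ((fun _ => m) e - ζ e) ∂μ = 0
      have := T.integral_comp_comm ((integrable_const m).sub hζi)
      refine this.trans ?_
      have h2 : ∫ e, ((fun _ : EuclideanSpace ℝ (Fin n) => m) - (ζ : EuclideanSpace ℝ (Fin n) → C(K, ℂ))) e ∂μ = 0 := by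
        refine (integral_sub (integrable_const m) hζi).trans ?_
        simp [hm]
      rw [h2, map_zero])
    N hN (N * r) (by positivity)
  have hfin : 2 * Real.exp (- (N * r) ^ 2 / (2 * N * (2 * Real.sqrt V) ^ 2)) = η := by
    have : - (N * r) ^ 2 / (2 * N * (2 * Real.sqrt V) ^ 2) = - L := by
      rw [hr]
      simp only [mul_pow, div_pow]
      rw [Real.sq_sqrt hVpos.le, Real.sq_sqrt hL.le, Real.sq_sqrt hN'.le,
        Real.sq_sqrt (by norm_num)]
      field_simp
    rw [this, Real.exp_neg, hLdef, Real.exp_log (by have := hη.1; positivity)]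
    have := hη.1
    field_simp
  rw [hfin] at key
  refine (measure_mono ?_).trans key
  intro x hx
  simp only [Set.mem_ofPred_eq, not_le] at hx ⊢
  have hcast : (N : ℂ) ≠ 0 := by exact_mod_cast hN'.ne'
  have hsum : ∑ j, g (x j) = (N : ℝ) • T (m - (N : ℝ)⁻¹ • ∑ j, ζ (x j)) := by
    simp only [g]
    rw [← map_sum, ← map_smul, Finset.sum_sub_distrib, smul_sub, smul_smul,
      mul_inv_cancel₀ hN'.ne', one_smul]
    simp [← Nat.cast_smul_eq_nsmul ℝ]
  have hint : ‖T (m - (N : ℝ)⁻¹ • ∑ j, ζ (x j))‖ₑ = (∫⁻ z in K,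
            (‖(∫ x, Complex.exp (Complex.I * ((2 * Real.pi * ⟪z, x⟫ : ℝ) : ℂ)) ∂μ) -
              (N : ℂ)⁻¹ * ∑ j, Complex.exp
                (Complex.I * ((2 * Real.pi * ⟪z, x j⟫ : ℝ) : ℂ))‖₊ : ℝ≥0∞) ^ 2) ^ (1/2 : ℝ) := by
    rw [hTn, ← lintegral_subtype_comap hKm]
    congr 2
    ext z
    rw [ContinuousMap.sub_apply, hmz, ContinuousMap.smul_apply, ContinuousMap.sum_apply,
      Complex.real_smul]
    simp only [hζ, Complex.ofReal_inv, Complex.ofReal_natCast]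
  rw [← hint, ← ofReal_norm, ENNReal.ofReal_lt_ofReal_iff_of_nonneg hr0.le] at hx
  rw [hsum, norm_smul, Real.norm_of_nonneg hN'.le]
  gcongr

open scoped ENNReal RealInnerProductSpace

/-- Single-time concentration of the empirical characteristic function: with probability at
least `1 - η`, the `L²` distance over the ball `{‖z‖ ≤ R}` between the characteristic function
`χ_μ` and the empirical characteristic function of `N` i.i.d. samples from `μ` is at most
`2√2 (V_n R^n)^{1/2} (log(2/η))^{1/2} / √N`. -/
theorem stmt7 (n N : ℕ) (hn : 1 ≤ n) (hN : 1 ≤ N) (R : ℝ) (hR : 0 < R)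
    (η : ℝ) (hη : η ∈ Set.Ioo (0 : ℝ) 1)
    {Ω : Type*} [MeasurableSpace Ω] (P : Measure Ω) [IsProbabilityMeasure P]
    (μ : Measure (EuclideanSpace ℝ (Fin n))) [IsProbabilityMeasure μ]
    (X : Fin N → Ω → EuclideanSpace ℝ (Fin n))
    (hmeas : ∀ j, Measurable (X j))
    (hindep : ProbabilityTheory.iIndepFun X P)
    (hlaw : ∀ j, Measure.map (X j) P = μ) :
    ENNReal.ofReal (1 - η) ≤
      P {ω | (∫⁻ z in {z : EuclideanSpace ℝ (Fin n) | ‖z‖ ≤ R},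
            (‖(∫ x, Complex.exp (Complex.I * ((2 * Real.pi * ⟪z, x⟫ : ℝ) : ℂ)) ∂μ) -
              (N : ℂ)⁻¹ * ∑ j, Complex.exp
                (Complex.I * ((2 * Real.pi * ⟪z, X j ω⟫ : ℝ) : ℂ))‖₊ : ℝ≥0∞) ^ 2) ^ (1/2 : ℝ) ≤
          ENNReal.ofReal (2 * Real.sqrt 2 *
            Real.sqrt ((volume (Metric.closedBall (0 : EuclideanSpace ℝ (Fin n)) 1)).toReal
              * R ^ n) * Real.sqrt (Real.log (2 / η)) / Real.sqrt N)} := by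
  have hmX : Measurable (fun ω j => X j ω) := measurable_pi_lambda _ hmeas
  have hmap : Measure.map (fun ω j => X j ω) P = Measure.pi fun _ : Fin N => μ := by
    rw [(ProbabilityTheory.iIndepFun_iff_map_fun_eq_pi_map
      (fun j => (hmeas j).aemeasurable)).1 hindep]
    simp only [hlaw]
  have key := charfun_conc n N hN R hR η hη μ
  rw [← hmap] at key
  have key2 := (Measure.le_map_apply hmX.aemeasurable _).trans key
  rw [ENNReal.ofReal_sub _ hη.1.le, ENNReal.ofReal_one, tsub_le_iff_right]
  have h1 : (1 : ℝ≥0∞) = P Set.univ := measure_univ.symm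
  rw [h1, ← Set.union_compl_self {ω | (∫⁻ z in {z : EuclideanSpace ℝ (Fin n) | ‖z‖ ≤ R},
            (‖(∫ x, Complex.exp (Complex.I * ((2 * Real.pi * ⟪z, x⟫ : ℝ) : ℂ)) ∂μ) -
              (N : ℂ)⁻¹ * ∑ j, Complex.exp
                (Complex.I * ((2 * Real.pi * ⟪z, X j ω⟫ : ℝ) : ℂ))‖₊ : ℝ≥0∞) ^ 2) ^ (1/2 : ℝ) ≤
          ENNReal.ofReal (2 * Real.sqrt 2 *
            Real.sqrt ((volume (Metric.closedBall (0 : EuclideanSpace ℝ (Fin n)) 1)).toReal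
              * R ^ n) * Real.sqrt (Real.log (2 / η)) / Real.sqrt N)}]
  refine (measure_union_le _ _).trans ?_
  gcongr
  exact key2
end

section
/- Let n ≥ 1, M ≥ 1, N ≥ 1 be integers, R > 0, and δ ∈ (0, 1). Let μ₁, …, μ_M be probability measures on ℝ^n and let {X_{ℓ,j} : 1 ≤ ℓ ≤ M, 1 ≤ j ≤ N} be mutually independent ℝ^n-valued random variables on a probability space (Ω, P) such that X_{ℓ,j} has law μ_ℓ. Write χ_{μ_ℓ}(z) = ∫ e^{2πi⟨z,x⟩} dμ_ℓ(x). Then with probability at least 1 − δ one has, simultaneously for all ℓ = 1, …, M, ( ∫_{‖z‖ ≤ R} | χ_{μ_ℓ}(z) − (1/N) Σ_{j=1}^N e^{2πi⟨z,X_{ℓ,j}⟩} |² dz )^{1/2} ≤ 3 · (V_n R^n)^{1/2} · (log(4M/δ))^{1/2} / √N, where V_n is the Lebesgue volume of the unit ball in ℝ^n. -/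
open MeasureTheory
open scoped ENNReal RealInnerProductSpace

lemma aux_cosh (a c : ℝ) (ha : 0 ≤ a) (hc : 0 ≤ c) :
    ∃ k : ℝ, ∀ T x : ℝ, 0 ≤ T → T ^ 2 ≤ a ^ 2 + 2 * x + c ^ 2 → |x| ≤ a * c →
      Real.cosh T ≤ Real.cosh a * Real.cosh c + k * x := by
  rcases ha.eq_or_lt with rfl | ha
  · refine ⟨0, fun T x hT h hx => ?_⟩
    have hx0 : x = 0 := by simpa using hx
    subst hx0
    have : T ≤ c := by
      apply le_of_sq_le_sq _ hc
      simpa using h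
    simpa [abs_of_nonneg hT, abs_of_nonneg hc] using this
  rcases hc.eq_or_lt with rfl | hc
  · refine ⟨0, fun T x hT h hx => ?_⟩
    have hx0 : x = 0 := by simpa using hx
    subst hx0
    have : T ≤ a := by
      apply le_of_sq_le_sq _ ha.le
      simpa using h
    simpa [abs_of_nonneg hT, abs_of_nonneg ha.le] using this
  refine ⟨Real.sinh a * Real.sinh c / (a * c), fun T x hT h hx => ?_⟩
  have hac : 0 < a * c := mul_pos ha hc
  obtain ⟨θ, rfl⟩ : ∃ θ, x = a * c * θ := ⟨x / (a * c), by field_simp⟩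
  have hθ : |θ| ≤ 1 := by
    rw [abs_mul, abs_of_pos hac] at hx
    exact le_of_mul_le_mul_left (by simpa using hx) hac
  obtain ⟨h1, h2⟩ := abs_le.mp hθ
  have key : Real.cosh T ≤ (1 + θ) / 2 * Real.cosh (a + c) + (1 - θ) / 2 * Real.cosh (a - c) := by
    refine hasSum_le (fun k => ?_) (Real.hasSum_cosh T)
      (((Real.hasSum_cosh (a + c)).mul_left ((1 + θ) / 2)).add
      ((Real.hasSum_cosh (a - c)).mul_left ((1 - θ) / 2)))
    have e1 : T ^ (2 * k) ≤
        (1 + θ) / 2 * (a + c) ^ (2 * k) + (1 - θ) / 2 * (a - c) ^ (2 * k) := by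
      rw [pow_mul, pow_mul, pow_mul]
      have e2 : T ^ 2 ≤ (1 + θ) / 2 * (a + c) ^ 2 + (1 - θ) / 2 * (a - c) ^ 2 := by
        nlinarith
      refine (pow_le_pow_left₀ (sq_nonneg T) e2 k).trans ?_
      have := (convexOn_pow (𝕜 := ℝ) k).2 (Set.mem_Ici.2 (sq_nonneg (a + c)))
        (Set.mem_Ici.2 (sq_nonneg (a - c))) (show 0 ≤ (1 + θ) / 2 by linarith)
        (show 0 ≤ (1 - θ) / 2 by linarith) (by ring)
      simpa only [smul_eq_mul] using this
    calc T ^ (2 * k) / ((2 * k).factorial : ℝ)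
        ≤ ((1 + θ) / 2 * (a + c) ^ (2 * k) + (1 - θ) / 2 * (a - c) ^ (2 * k)) /
          ((2 * k).factorial : ℝ) := by gcongr
      _ = _ := by ring
  rw [Real.cosh_add, Real.cosh_sub] at key
  have : Real.sinh a * Real.sinh c / (a * c) * (a * c * θ) = Real.sinh a * Real.sinh c * θ := by
    field_simp
  rw [this]
  linarith

section abs
variable {E H : Type*} [TopologicalSpace E] [SecondCountableTopology E] [MeasurableSpace E]
  [BorelSpace E] [NormedAddCommGroup H] [InnerProductSpace ℝ H] [CompleteSpace H]

lemma aux_integrable {E H : Type*} [TopologicalSpace E] [SecondCountableTopology E]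
    [MeasurableSpace E] [BorelSpace E] [NormedAddCommGroup H]
    (ν : Measure E) [IsFiniteMeasure ν] (d : E → H)
    (hd : Continuous d) (c : ℝ) (hdc : ∀ x, ‖d x‖ ≤ c) : Integrable d ν :=
  Integrable.of_bound hd.aestronglyMeasurable c (ae_of_all _ hdc)

lemma aux_cosh_int {E H : Type*} [TopologicalSpace E] [SecondCountableTopology E]
    [MeasurableSpace E] [BorelSpace E] [NormedAddCommGroup H] (ν : Measure E) [IsFiniteMeasure ν] (d : E → H)
    (hd : Continuous d) (c : ℝ) (hdc : ∀ x, ‖d x‖ ≤ c) (l : ℝ) (hl : 0 ≤ l) :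
    Integrable (fun x => Real.cosh (l * ‖d x‖)) ν := by
  refine aux_integrable ν _ (by fun_prop) (Real.cosh (l * c)) (fun x => ?_)
  rw [Real.norm_of_nonneg (Real.cosh_pos _).le, Real.cosh_le_cosh,
    abs_of_nonneg (by positivity)]
  exact (mul_le_mul_of_nonneg_left (hdc x) hl).trans (le_abs_self _)

lemma aux_step (ν : Measure E) [IsProbabilityMeasure ν] (d : E → H)
    (hd : Continuous d) (c : ℝ) (hc : 0 ≤ c) (hdc : ∀ x, ‖d x‖ ≤ c) (h0 : ∫ x, d x ∂ν = 0)
    (l : ℝ) (hl : 0 ≤ l) (s : H) :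
    ∫ x, Real.cosh (l * ‖s + d x‖) ∂ν ≤ Real.cosh (l * ‖s‖) * Real.cosh (l * c) := by
  obtain ⟨k, hk⟩ := aux_cosh (l * ‖s‖) (l * c) (by positivity) (by positivity)
  have hdi := aux_integrable ν d hd c hdc
  have hin : Integrable (fun x => ⟪s, d x⟫) ν := hdi.const_inner s
  have hi : ∫ x, ⟪s, d x⟫ ∂ν = 0 := by rw [integral_inner hdi, h0, inner_zero_right]
  calc ∫ x, Real.cosh (l * ‖s + d x‖) ∂ν
      ≤ ∫ x, (Real.cosh (l * ‖s‖) * Real.cosh (l * c) + k * (l ^ 2 * ⟪s, d x⟫)) ∂ν := by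
        refine integral_mono ?_ ?_ (fun x => ?_)
        · exact aux_cosh_int ν (fun x => s + d x) (by fun_prop) (‖s‖ + c)
            (fun x => (norm_add_le _ _).trans (by linarith [hdc x])) l hl
        · exact (integrable_const _).add ((hin.const_mul _).const_mul _)
        · refine hk _ _ (by positivity) ?_ ?_
          · rw [mul_pow, norm_add_sq_real]
            have : ‖d x‖ ^ 2 ≤ c ^ 2 := pow_le_pow_left₀ (norm_nonneg _) (hdc x) 2
            nlinarith [sq_nonneg l]
          · rw [abs_mul, abs_of_nonneg (sq_nonneg l)]
            have : |⟪s, d x⟫| ≤ ‖s‖ * c :=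
              (abs_real_inner_le_norm _ _).trans (by gcongr; exact hdc x)
            nlinarith [sq_nonneg l]
    _ = _ := by
        rw [integral_add (integrable_const _) ((hin.const_mul _).const_mul _),
          integral_const_mul k, integral_const_mul (l ^ 2), hi]
        simp

lemma aux_induct {Ω ι : Type*} [MeasurableSpace Ω] (P : Measure Ω) [IsProbabilityMeasure P]
    (ν : Measure E) [IsProbabilityMeasure ν] (d : E → H)
    (hd : Continuous d) (c : ℝ) (hc : 0 ≤ c) (hdc : ∀ x, ‖d x‖ ≤ c) (h0 : ∫ x, d x ∂ν = 0)
    (l : ℝ) (hl : 0 ≤ l) (Y : ι → Ω → E) (hY : ∀ i, Measurable (Y i))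
    (hind : ProbabilityTheory.iIndepFun Y P) (hlaw : ∀ i, P.map (Y i) = ν) (t : Finset ι) :
    ∫ ω, Real.cosh (l * ‖∑ i ∈ t, d (Y i ω)‖) ∂P ≤ Real.cosh (l * c) ^ t.card := by
  classical
  induction t using Finset.induction_on with
  | empty => simp
  | insert i t hi ih =>
    have hI : ProbabilityTheory.IndepFun (fun ω (j : t) => Y j ω) (Y i) P := by
      have := hind.indepFun_finset t {i} (by simpa using hi) hY
      exact this.comp (φ := id) (ψ := fun g : ({i} : Finset ι) → E => g ⟨i, by simp⟩)
        measurable_id (measurable_pi_apply (⟨i, by simp⟩ : ({i} : Finset ι)))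
    have hm : Measurable (fun ω (j : t) => Y j ω) := measurable_pi_lambda _ (fun j => hY j)
    rw [ProbabilityTheory.indepFun_iff_map_prod_eq_prod_map_map hm.aemeasurable
      (hY i).aemeasurable, hlaw] at hI
    set Q := P.map (fun ω (j : t) => Y j ω) with hQ
    have : IsProbabilityMeasure Q := Measure.isProbabilityMeasure_map hm.aemeasurable
    have hcont : Continuous (fun y : t → E => ∑ j, d (y j)) := by fun_prop
    have hbd : ∀ y : t → E, ‖∑ j, d (y j)‖ ≤ t.card * c := fun y => by
      refine (norm_sum_le_of_le _ (fun j _ => hdc (y j))).trans ?_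
      simp
    have hint := aux_cosh_int Q (fun y : t → E => ∑ j, d (y j)) hcont _ hbd l hl
    have hcont2 : Continuous (fun y : (t → E) × E => ∑ j, d (y.1 j) + d y.2) := by fun_prop
    have hint2 := aux_cosh_int (Q.prod ν) _ hcont2
      (t.card * c + c) (fun y => (norm_add_le _ _).trans (add_le_add (hbd _) (hdc _))) l hl
    calc ∫ ω, Real.cosh (l * ‖∑ i ∈ insert i t, d (Y i ω)‖) ∂P
        = ∫ y, Real.cosh (l * ‖∑ j, d (y.1 j) + d y.2‖) ∂(Q.prod ν) := by
          rw [← hI, integral_map (hm.prodMk (hY i)).aemeasurable]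
          · refine integral_congr_ae (ae_of_all _ fun ω => ?_)
            simp only
            rw [Finset.sum_insert hi, add_comm, ← Finset.sum_coe_sort t]
          · rw [hI]; exact hint2.1
      _ = ∫ y, ∫ x, Real.cosh (l * ‖∑ j, d (y j) + d x‖) ∂ν ∂Q := integral_prod _ hint2
      _ ≤ ∫ y, Real.cosh (l * ‖∑ j, d (y j)‖) * Real.cosh (l * c) ∂Q := by
          refine integral_mono hint2.integral_prod_left (hint.mul_const _) (fun y => ?_)
          exact aux_step ν d hd c hc hdc h0 l hl _
      _ = (∫ ω, Real.cosh (l * ‖∑ i ∈ t, d (Y i ω)‖) ∂P) * Real.cosh (l * c) := by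
          rw [integral_mul_const, hQ, integral_map hm.aemeasurable hint.1]
          congr 1
          refine integral_congr_ae (ae_of_all _ fun ω => ?_)
          simp only
          rw [← Finset.sum_coe_sort t]
      _ ≤ _ := by
          rw [Finset.card_insert_of_notMem hi, pow_succ]
          exact mul_le_mul_of_nonneg_right ih (Real.cosh_pos _).le

lemma aux_tail {Ω : Type*} [MeasurableSpace Ω] (P : Measure Ω) [IsProbabilityMeasure P]
    (ν : Measure E) [IsProbabilityMeasure ν] (d : E → H)
    (hd : Continuous d) (c : ℝ) (hc : 0 < c) (hdc : ∀ x, ‖d x‖ ≤ c) (h0 : ∫ x, d x ∂ν = 0)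
    (N : ℕ) (hN : 1 ≤ N) (Y : Fin N → Ω → E) (hY : ∀ i, Measurable (Y i))
    (hind : ProbabilityTheory.iIndepFun Y P) (hlaw : ∀ i, P.map (Y i) = ν) (r : ℝ) (hr : 0 ≤ r) :
    P.real {ω | r ≤ ‖∑ i, d (Y i ω)‖} ≤ 2 * Real.exp (- r ^ 2 / (2 * N * c ^ 2)) := by
  have hN' : (0 : ℝ) < N := by exact_mod_cast hN
  set l := r / (N * c ^ 2) with hl_def
  have hl : 0 ≤ l := by positivity
  have h1 := aux_induct P ν d hd c hc.le hdc h0 l hl Y hY hind hlaw Finset.univ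
  rw [Finset.card_univ, Fintype.card_fin] at h1
  have hm : Measurable (fun ω j => Y j ω) := measurable_pi_lambda _ (fun j => hY j)
  have hint : Integrable (fun ω => Real.cosh (l * ‖∑ i, d (Y i ω)‖)) P := by
    have hp : IsProbabilityMeasure (P.map (fun ω j => Y j ω)) :=
      Measure.isProbabilityMeasure_map hm.aemeasurable
    have := aux_cosh_int (P.map (fun ω j => Y j ω)) (fun y : Fin N → E => ∑ j, d (y j))
      (by fun_prop) (N * c) (fun y => by
        refine (norm_sum_le_of_le _ (fun j _ => hdc (y j))).trans ?_
        simp) l hl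
    exact this.comp_measurable hm
  have h2 := mul_meas_ge_le_integral_of_nonneg (ae_of_all P fun ω => (Real.cosh_pos _).le) hint
    (Real.cosh (l * r))
  have h3 : P.real {ω | r ≤ ‖∑ i, d (Y i ω)‖} ≤
      P.real {ω | Real.cosh (l * r) ≤ Real.cosh (l * ‖∑ i, d (Y i ω)‖)} := by
    refine measureReal_mono (fun ω hω => ?_)
    simp only [Set.mem_ofPred_eq] at hω ⊢
    rw [Real.cosh_le_cosh, abs_of_nonneg (by positivity), abs_of_nonneg (by positivity)]
    gcongr
  set p := P.real {ω | r ≤ ‖∑ i, d (Y i ω)‖}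
  have h4 : Real.exp (l * r) / 2 * p ≤ Real.exp (N * ((l * c) ^ 2 / 2)) := by
    calc _ ≤ Real.cosh (l * r) * p := by
          gcongr
          rw [Real.cosh_eq]
          linarith [Real.exp_pos (-(l * r))]
      _ ≤ _ := mul_le_mul_of_nonneg_left h3 (Real.cosh_pos _).le
      _ ≤ _ := h2
      _ ≤ _ := h1
      _ ≤ Real.exp ((l * c) ^ 2 / 2) ^ N :=
          pow_le_pow_left₀ (Real.cosh_pos _).le (Real.cosh_le_exp_half_sq _) _
      _ = _ := (Real.exp_nat_mul _ _).symm
  have h5 : - r ^ 2 / (2 * N * c ^ 2) = N * ((l * c) ^ 2 / 2) - l * r := by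
    rw [hl_def]; field_simp; ring
  rw [h5, Real.exp_sub, mul_div_assoc', le_div_iff₀ (Real.exp_pos _)]
  linarith
end abs

section conc
variable {n : ℕ} (R : ℝ)

abbrev auxK (n : ℕ) (R : ℝ) : Set (EuclideanSpace ℝ (Fin n)) := Metric.closedBall 0 R

noncomputable abbrev auxm (n : ℕ) (R : ℝ) : Measure (auxK n R) :=
  Measure.comap Subtype.val (volume : Measure (EuclideanSpace ℝ (Fin n)))

lemma auxm_univ (n : ℕ) (R : ℝ) : auxm n R Set.univ = volume (auxK n R) := by
  rw [comap_subtype_coe_apply Metric.isClosed_closedBall.measurableSet, Set.image_univ,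
    Subtype.range_coe]

instance auxm_fin (n : ℕ) (R : ℝ) : IsFiniteMeasure (auxm n R) := by
  refine ⟨?_⟩
  rw [auxm_univ]
  exact measure_closedBall_lt_top

noncomputable def auxG (n : ℕ) (R : ℝ) : C(EuclideanSpace ℝ (Fin n), C(auxK n R, ℂ)) :=
  ContinuousMap.curry ⟨fun p : EuclideanSpace ℝ (Fin n) × auxK n R =>
    Complex.exp (Complex.I * ((2 * Real.pi * ⟪(p.2 : EuclideanSpace ℝ (Fin n)), p.1⟫ : ℝ) : ℂ)),
    by fun_prop⟩

lemma auxG_apply (n : ℕ) (R : ℝ) (x) (z : auxK n R) : auxG n R x z =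
    Complex.exp (Complex.I * ((2 * Real.pi * ⟪(z : EuclideanSpace ℝ (Fin n)), x⟫ : ℝ) : ℂ)) := rfl

lemma auxG_norm (n : ℕ) (R : ℝ) (x) : ‖auxG n R x‖ ≤ 1 := by
  rw [ContinuousMap.norm_le _ zero_le_one]
  intro z
  rw [auxG_apply, mul_comm, Complex.norm_exp_ofReal_mul_I]

noncomputable abbrev auxT (n : ℕ) (R : ℝ) : C(auxK n R, ℂ) →L[ℝ] Lp ℂ 2 (auxm n R) :=
  ContinuousMap.toLp 2 (auxm n R) ℝ

lemma auxT_norm (n : ℕ) (R : ℝ) : ‖auxT n R‖ ≤ Real.sqrt (volume (auxK n R)).toReal := by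
  refine (ContinuousMap.toLp_norm_le (auxm n R)).trans (le_of_eq ?_)
  rw [Real.sqrt_eq_rpow, ← auxm_univ]
  simp [measureUnivNNReal, ENNReal.coe_toNNReal_eq_toReal]

lemma auxT_lint (n : ℕ) (R : ℝ) (h : C(auxK n R, ℂ)) (F : EuclideanSpace ℝ (Fin n) → ℂ)
    (hF : ∀ z : auxK n R, F z = h z) :
    (∫⁻ z in {z : EuclideanSpace ℝ (Fin n) | ‖z‖ ≤ R}, (‖F z‖₊ : ℝ≥0∞) ^ 2) ^ (1/2 : ℝ) =
      ENNReal.ofReal ‖auxT n R h‖ := by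
  have e : {z : EuclideanSpace ℝ (Fin n) | ‖z‖ ≤ R} = auxK n R := by
    ext z; simp [auxK]
  rw [e, ← lintegral_subtype_comap Metric.isClosed_closedBall.measurableSet, Lp.norm_def,
    ENNReal.ofReal_toReal (Lp.eLpNorm_ne_top _),
    eLpNorm_congr_ae (ContinuousMap.coeFn_toLp (auxm n R) h),
    eLpNorm_eq_lintegral_rpow_enorm_toReal (by simp) (by simp)]
  simp [hF, enorm_eq_nnnorm]

lemma aux_single (n N : ℕ) (hN : 1 ≤ N) (R : ℝ) (hR : 0 < R) (η : ℝ) (hη : 0 < η) (hη1 : η ≤ 1)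
    {Ω : Type*} [MeasurableSpace Ω] (P : Measure Ω) [IsProbabilityMeasure P]
    (ν : Measure (EuclideanSpace ℝ (Fin n))) [IsProbabilityMeasure ν]
    (X : Fin N → Ω → EuclideanSpace ℝ (Fin n)) (hX : ∀ j, Measurable (X j))
    (hind : ProbabilityTheory.iIndepFun X P) (hlaw : ∀ j, P.map (X j) = ν) :
    P {ω | ¬ (∫⁻ z in {z : EuclideanSpace ℝ (Fin n) | ‖z‖ ≤ R},
            (‖(∫ x, Complex.exp (Complex.I * ((2 * Real.pi * ⟪z, x⟫ : ℝ) : ℂ)) ∂ν) -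
              (N : ℂ)⁻¹ * ∑ j, Complex.exp
                (Complex.I * ((2 * Real.pi * ⟪z, X j ω⟫ : ℝ) : ℂ))‖₊ : ℝ≥0∞) ^ 2) ^ (1/2 : ℝ) ≤
          ENNReal.ofReal (3 *
            Real.sqrt ((volume (Metric.closedBall (0 : EuclideanSpace ℝ (Fin n)) 1)).toReal
              * R ^ n) * Real.sqrt (Real.log (4 / η)) / Real.sqrt N)} ≤ ENNReal.ofReal η := by
  have hN' : (0 : ℝ) < N := by exact_mod_cast hN
  have hV : (volume (Metric.closedBall (0 : EuclideanSpace ℝ (Fin n)) 1)).toReal * R ^ n =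
      (volume (auxK n R)).toReal := by
    rw [Measure.addHaar_closedBall' _ _ hR.le, ENNReal.toReal_mul,
      ENNReal.toReal_ofReal (by positivity)]
    simp [mul_comm]
  rw [hV]
  set V := (volume (auxK n R)).toReal with hVdef
  have hVpos : 0 < V := ENNReal.toReal_pos (Metric.measure_closedBall_pos volume _ hR).ne'
    measure_closedBall_lt_top.ne
  set L := Real.log (4 / η) with hLdef
  have hL : 0 ≤ L := Real.log_nonneg (by rw [le_div_iff₀ hη]; linarith)
  set χ : C(auxK n R, ℂ) := ∫ x, auxG n R x ∂ν with hχ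
  have hGi : Integrable (fun x => auxG n R x) ν :=
    aux_integrable ν _ (auxG n R).continuous 1 (auxG_norm n R)
  have hχn : ‖χ‖ ≤ 1 := by
    refine (norm_integral_le_of_norm_le_const (ae_of_all _ (auxG_norm n R))).trans ?_
    simp
  have hχz : ∀ z : auxK n R, χ z = ∫ x, auxG n R x z ∂ν := fun z =>
    ((ContinuousMap.evalCLM ℝ z).integral_comp_comm hGi).symm
  set d : EuclideanSpace ℝ (Fin n) → Lp ℂ 2 (auxm n R) := fun x => auxT n R (χ - auxG n R x)
    with hd
  have hdc : Continuous d := (auxT n R).continuous.comp (continuous_const.sub (auxG n R).continuous)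
  have hdn : ∀ x, ‖d x‖ ≤ 2 * Real.sqrt V := fun x => by
    refine ((auxT n R).le_opNorm _).trans ?_
    rw [mul_comm]
    refine mul_le_mul ?_ (auxT_norm n R) (norm_nonneg _) (by norm_num)
    refine (norm_sub_le _ _).trans ?_
    linarith [auxG_norm n R x]
  have hd0 : ∫ x, d x ∂ν = 0 := by
    have hi : Integrable (fun x => χ - auxG n R x) ν := (integrable_const _).sub hGi
    refine ((auxT n R).integral_comp_comm hi).trans ?_
    rw [integral_sub (integrable_const _) hGi]
    simp [← hχ]
  have hsV : 0 < Real.sqrt V := Real.sqrt_pos.2 hVpos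
  have hsN : 0 < Real.sqrt N := Real.sqrt_pos.2 hN'
  have tail := aux_tail P ν d hdc (2 * Real.sqrt V) (by positivity) hdn hd0 N hN X hX hind hlaw
    (3 * Real.sqrt V * Real.sqrt L * Real.sqrt N) (by positivity)
  have hb : 2 * Real.exp (-(3 * Real.sqrt V * Real.sqrt L * Real.sqrt N) ^ 2 /
      (2 * N * (2 * Real.sqrt V) ^ 2)) ≤ η := by
    have e1 : -(3 * Real.sqrt V * Real.sqrt L * Real.sqrt N) ^ 2 /
      (2 * N * (2 * Real.sqrt V) ^ 2) = - (9 / 8 * L) := by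
      simp only [mul_pow, Real.sq_sqrt hVpos.le, Real.sq_sqrt hL, Real.sq_sqrt hN'.le]
      field_simp
      ring
    rw [e1]
    have : Real.exp (-(9 / 8 * L)) ≤ Real.exp (-L) := Real.exp_le_exp.2 (by linarith)
    rw [Real.exp_neg L, hLdef, Real.exp_log (by positivity), inv_div] at this
    linarith
  have hfin := tail.trans hb
  rw [Measure.real, ← ENNReal.le_ofReal_iff_toReal_le (measure_ne_top _ _) hη.le] at hfin
  refine (measure_mono fun ω hω => ?_).trans hfin
  simp only [Set.mem_ofPred_eq] at hω ⊢
  rw [auxT_lint n R ((N : ℝ)⁻¹ • ∑ j, (χ - auxG n R (X j ω)))] at hω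
  · rw [ENNReal.ofReal_le_ofReal_iff (by positivity), not_le, map_smul, norm_smul, map_sum,
      Real.norm_of_nonneg (by positivity), div_lt_iff₀ hsN] at hω
    have h2 : Real.sqrt N * Real.sqrt N = N := Real.mul_self_sqrt hN'.le
    have h3 : 3 * Real.sqrt V * Real.sqrt L * Real.sqrt N <
      (N : ℝ)⁻¹ * ‖∑ j, d (X j ω)‖ * Real.sqrt N * Real.sqrt N :=
        mul_lt_mul_of_pos_right hω hsN
    rw [mul_assoc _ (Real.sqrt N), h2] at h3
    refine h3.le.trans (le_of_eq ?_)
    field_simp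
  · intro z
    have hN0 : (N : ℂ) ≠ 0 := by exact_mod_cast hN'.ne'
    simp only [ContinuousMap.smul_apply, ContinuousMap.sum_apply, ContinuousMap.sub_apply,
      Finset.sum_sub_distrib, hχz, auxG_apply, Complex.real_smul]
    simp only [Finset.sum_const, Finset.card_univ, Fintype.card_fin, nsmul_eq_mul]
    push_cast
    field_simp
end conc

/-- Uniform-in-time concentration of empirical characteristic functions: if
`X_{ℓ,j}` (`1 ≤ ℓ ≤ M`, `1 ≤ j ≤ N`) are mutually independent with `X_{ℓ,j} ~ μ_ℓ`, then with
probability at least `1 - δ`, simultaneously for all `ℓ`, the `L²` distance over the ball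
`{‖z‖ ≤ R}` between `χ_{μ_ℓ}` and the empirical characteristic function of the `ℓ`-th sample is
at most `3 (V_n R^n)^{1/2} (log(4M/δ))^{1/2} / √N`. -/
theorem stmt8 (n M N : ℕ) (hn : 1 ≤ n) (hM : 1 ≤ M) (hN : 1 ≤ N) (R : ℝ) (hR : 0 < R)
    (δ : ℝ) (hδ : δ ∈ Set.Ioo (0 : ℝ) 1)
    {Ω : Type*} [MeasurableSpace Ω] (P : Measure Ω) [IsProbabilityMeasure P]
    (μ : Fin M → Measure (EuclideanSpace ℝ (Fin n))) (hμ : ∀ ℓ, IsProbabilityMeasure (μ ℓ))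
    (X : Fin M → Fin N → Ω → EuclideanSpace ℝ (Fin n))
    (hmeas : ∀ ℓ j, Measurable (X ℓ j))
    (hindep : ProbabilityTheory.iIndepFun
      (fun p : Fin M × Fin N => X p.1 p.2) P)
    (hlaw : ∀ ℓ j, Measure.map (X ℓ j) P = μ ℓ) :
    ENNReal.ofReal (1 - δ) ≤
      P {ω | ∀ ℓ : Fin M,
          (∫⁻ z in {z : EuclideanSpace ℝ (Fin n) | ‖z‖ ≤ R},
            (‖(∫ x, Complex.exp (Complex.I * ((2 * Real.pi * ⟪z, x⟫ : ℝ) : ℂ)) ∂(μ ℓ)) -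
              (N : ℂ)⁻¹ * ∑ j, Complex.exp
                (Complex.I * ((2 * Real.pi * ⟪z, X ℓ j ω⟫ : ℝ) : ℂ))‖₊ : ℝ≥0∞) ^ 2) ^ (1/2 : ℝ) ≤
          ENNReal.ofReal (3 *
            Real.sqrt ((volume (Metric.closedBall (0 : EuclideanSpace ℝ (Fin n)) 1)).toReal
              * R ^ n) * Real.sqrt (Real.log (4 * M / δ)) / Real.sqrt N)} := by
  have hM' : (0 : ℝ) < M := by exact_mod_cast hM
  have h1 : ∀ ℓ : Fin M, P _ ≤ ENNReal.ofReal (δ / M) := fun ℓ =>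
    haveI := hμ ℓ
    aux_single n N hN R hR (δ / M) (div_pos hδ.1 hM')
      ((div_le_one hM').2 (hδ.2.le.trans (by exact_mod_cast hM))) P (μ ℓ) (X ℓ) (hmeas ℓ)
      (hindep.precomp (g := fun j : Fin N => (ℓ, j)) (fun a b h => (Prod.ext_iff.1 h).2))
      (hlaw ℓ)
  have e : 4 / (δ / M) = 4 * M / δ := by
    have := hδ.1
    field_simp
  rw [e] at h1
  have h2 := (measure_iUnion_fintype_le P _).trans (Finset.sum_le_sum (fun ℓ (_ : ℓ ∈ Finset.univ) => h1 ℓ))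
  rw [Finset.sum_const, Finset.card_univ, Fintype.card_fin, nsmul_eq_mul,
    ← ENNReal.ofReal_natCast, ← ENNReal.ofReal_mul hM'.le, mul_div_cancel₀ _ hM'.ne'] at h2
  rw [ENNReal.ofReal_sub _ hδ.1.le, ENNReal.ofReal_one, tsub_le_iff_right]
  refine le_trans ?_ (add_le_add_right h2 _)
  rw [← measure_univ (μ := P)]
  refine (measure_mono ?_).trans (measure_union_le _ _)
  intro ω _
  rw [Set.mem_union, Set.mem_iUnion]
  refine or_iff_not_imp_left.2 (fun h => ?_)
  exact not_forall.1 h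
end
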